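/- arXiv:2303.06558 — 7 statements merged into one kernel-verified Lean document; each statement's English description precedes it below -/
import Mathlib

section
/- For every λ > 0 there exists a natural number N > 0 divisible by 4 such that the N × N symmetric circulant matrix K with entries K_{ij} = exp(−λ·((2π/N)·min(|i−j|, N−|i−j|))²), for i, j ∈ {0, 1, …, N−1}, is not positive semidefinite; equivalently, there exists v ∈ ℝ^N with vᵀ K v < 0 (K has a negative eigenvalue). -/
/-- If points `a, b, c, d` have Gram entries `1` on the diagonal, `p` for the pairs `ab`, `cd`,
`q` for `ac`, `bd`, and `r` for `ad`, `bc`, then the alternating vector `e_a - e_b + e_c - e_d`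
has quadratic form value `4 * ((1 - p) - (r - q))`. -/
theorem exists_quadForm_eq_of_four_points {ι : Type*} [Fintype ι] [DecidableEq ι]
    (K : ι → ι → ℝ) (hK : ∀ i j, K i j = K j i) (a b c d : ι) {p q r : ℝ}
    (hdiag : ∀ i, K i i = 1) (hab : K a b = p) (hcd : K c d = p) (hac : K a c = q)
    (hbd : K b d = q) (had : K a d = r) (hbc : K b c = r) :
    ∃ v : ι → ℝ, ∑ i, ∑ j, v i * v j * K i j = 4 * ((1 - p) - (r - q)) := by
  let v : ι → ℝ := fun i =>
    (if i = a then 1 else 0) - (if i = b then 1 else 0) +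
      (if i = c then 1 else 0) - (if i = d then 1 else 0)
  have hv (g : ι → ℝ) : ∑ i, v i * g i = g a - g b + g c - g d := by
    simp [v, sub_mul, add_mul, Finset.sum_add_distrib, Finset.sum_sub_distrib]
  refine ⟨v, ?_⟩
  simp_rw [mul_assoc, ← Finset.mul_sum, hv, hdiag, hK b a, hK c a, hK d a, hK c b, hK d b, hK d c,
    hab, hcd, hac, hbd, had, hbc]
  ring

/-- For small `h`, the Gaussian profile drops less between `0` and `h` than between `π - h`
and `π`. -/
theorem one_sub_gaussian_lt_gaussian_sub {lam h : ℝ} (hlam : 0 < lam) (h0 : 0 < h)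
    (hpi : h ≤ Real.pi) (hsmall : h < Real.pi * Real.exp (-lam * Real.pi ^ 2)) :
    1 - Real.exp (-lam * h ^ 2) <
      Real.exp (-lam * (Real.pi - h) ^ 2) - Real.exp (-lam * Real.pi ^ 2) := by
  have upper : 1 - Real.exp (-lam * h ^ 2) ≤ lam * h ^ 2 := by
    linarith [Real.add_one_le_exp (-lam * h ^ 2)]
  have split : Real.exp (-lam * (Real.pi - h) ^ 2) =
      Real.exp (-lam * Real.pi ^ 2) * Real.exp (lam * (2 * Real.pi * h - h ^ 2)) := by
    rw [← Real.exp_add]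
    ring_nf
  have growth : lam * (Real.pi * h) + 1 ≤ Real.exp (lam * (2 * Real.pi * h - h ^ 2)) := by
    refine le_trans ?_ (Real.add_one_le_exp _)
    gcongr
    nlinarith
  have lower := mul_le_mul_of_nonneg_left growth (Real.exp_pos (-lam * Real.pi ^ 2)).le
  have compare := mul_lt_mul_of_pos_left hsmall (mul_pos hlam h0)
  rw [split]
  nlinarith


/-- **Lemma (Da Costa–Mostajeran–Ortega).** For every `λ > 0` there is a positive `N`
divisible by 4 such that the `N × N` circulant matrix with entries
`exp (-λ * ((2π/N) * min |i-j| (N - |i-j|))²)` — the Gaussian Gram matrix of `N`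
equidistributed points on the round circle of circumference `2π` — is not positive
semidefinite, i.e. some vector `v` gives `vᵀ K v < 0`. -/
theorem circulant_gaussian_not_posSemidef (lam : ℝ) (hlam : 0 < lam) :
    ∃ N : ℕ, 0 < N ∧ 4 ∣ N ∧
      ∃ v : Fin N → ℝ,
        ∑ i : Fin N, ∑ j : Fin N,
          v i * v j *
            Real.exp (-lam * ((2 * Real.pi / N) *
              (min (((i : ℤ) - (j : ℤ)).natAbs) (N - ((i : ℤ) - (j : ℤ)).natAbs) : ℕ)) ^ 2)
          < 0 := by
  obtain ⟨m, hm⟩ := exists_nat_gt (Real.exp (-lam * Real.pi ^ 2))⁻¹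
  have hm_pos : (0 : ℝ) < m := (inv_pos.2 (Real.exp_pos _)).trans hm
  have hm1 : 1 ≤ m := by exact_mod_cast hm_pos
  have inv_lt : (m : ℝ)⁻¹ < Real.exp (-lam * Real.pi ^ 2) :=
    inv_lt_of_inv_lt₀ (Real.exp_pos _) hm
  refine ⟨4 * m, by omega, dvd_mul_right 4 m, ?_⟩
  set h : ℝ := 2 * Real.pi / ((4 * m : ℕ) : ℝ) with hh
  have h_mul : h * (2 * m) = Real.pi := by
    rw [hh]
    push_cast
    field_simp
    ring
  have h_pos : 0 < h := by positivity
  have h_le : h ≤ Real.pi := by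
    have : (1 : ℝ) ≤ m := by exact_mod_cast hm1
    nlinarith
  have h_lt : h < Real.pi * Real.exp (-lam * Real.pi ^ 2) := by
    have : h ≤ Real.pi * (m : ℝ)⁻¹ := by
      rw [← div_eq_mul_inv, le_div_iff₀ hm_pos]
      nlinarith
    exact this.trans_lt (mul_lt_mul_of_pos_left inv_lt Real.pi_pos)
  have entry {k l : ℕ} (hkl : k = l) {x : ℝ} (hx : h * l = x) :
      Real.exp (-lam * (h * (k : ℝ)) ^ 2) = Real.exp (-lam * x ^ 2) := by
    rw [hkl, hx]
  have h_one : h * ((1 : ℕ) : ℝ) = h := by simp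
  have h_half : h * ((2 * m : ℕ) : ℝ) = Real.pi := by exact_mod_cast h_mul
  have h_pred : h * ((2 * m - 1 : ℕ) : ℝ) = Real.pi - h := by
    rw [Nat.cast_sub (by omega), mul_sub, h_half, h_one]
  obtain ⟨v, hv⟩ := exists_quadForm_eq_of_four_points
    (fun i j : Fin (4 * m) => Real.exp (-lam * (h *
      (min (((i : ℤ) - (j : ℤ)).natAbs) (4 * m - ((i : ℤ) - (j : ℤ)).natAbs) : ℕ)) ^ 2))
    (fun i j => by
      rw [← Int.natAbs_neg ((i : ℤ) - (j : ℤ)), neg_sub])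
    ⟨0, by omega⟩ ⟨1, by omega⟩ ⟨2 * m, by omega⟩ ⟨2 * m + 1, by omega⟩
    (fun i => by simp)
    (entry (by dsimp only; omega) h_one) (entry (by dsimp only; omega) h_one)
    (entry (by dsimp only; omega) h_half) (entry (by dsimp only; omega) h_half)
    (entry (by dsimp only; omega) h_pred) (entry (by dsimp only; omega) h_pred)
  refine ⟨v, hv.trans_lt ?_⟩
  linarith [one_sub_gaussian_lt_gaussian_sub hlam h_pos h_le h_lt]
end

section
/- For every λ > 0 and every ρ > 0 there exist a natural number N > 0 and a real number ε > 0 with the following property: for every metric space (X,d) and every N-tuple of points x₀, …, x_{N−1} ∈ X satisfying |d(x_i, x_j) − (ρ/N)·min(|i−j|, N−|i−j|)| ≤ ε for all i, j ∈ {0, …, N−1}, the Gaussian Gram matrix G with entries G_{ij} = exp(−λ·d(x_i,x_j)²) is not positive semidefinite, i.e., there exists v ∈ ℝ^N with vᵀ G v < 0. -/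
open Filter Topology in
/-- Moving two antipodal pairs of points a small distance `h` along a circle of circumference
`2 * L` makes the Gaussian energy of the alternating weights negative, with room to spare. -/
lemma exists_gaussian_alternating_energy_neg {lam L h : ℝ} (hlam : 0 < lam) (hL : 0 < L)
    (hh : 0 < h) (hsmall : h < Real.exp (-lam * L ^ 2) * (2 * L - h)) :
    ∃ ε, 0 < ε ∧ ε < L ∧
      1 - Real.exp (-lam * (h + ε) ^ 2) + Real.exp (-lam * (L - ε) ^ 2)
        - Real.exp (-lam * (L - h + ε) ^ 2) < 0 := by
  have h0 : 1 - Real.exp (-lam * (h + 0) ^ 2) + Real.exp (-lam * (L - 0) ^ 2)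
      - Real.exp (-lam * (L - h + 0) ^ 2) < 0 := by
    have hnear := Real.add_one_le_exp (-lam * h ^ 2)
    have hfar := Real.add_one_le_exp (lam * (2 * L * h - h ^ 2))
    have hsplit : Real.exp (-lam * (L - h) ^ 2) =
        Real.exp (-lam * L ^ 2) * Real.exp (lam * (2 * L * h - h ^ 2)) := by
      rw [← Real.exp_add]; ring_nf
    have hscaled := mul_le_mul_of_nonneg_left hfar (Real.exp_pos (-lam * L ^ 2)).le
    have hgap := mul_lt_mul_of_pos_left hsmall (mul_pos hlam hh)
    simp only [add_zero, sub_zero]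
    rw [hsplit]
    nlinarith
  have hcont : Continuous fun ε : ℝ ↦ 1 - Real.exp (-lam * (h + ε) ^ 2)
      + Real.exp (-lam * (L - ε) ^ 2) - Real.exp (-lam * (L - h + ε) ^ 2) := by fun_prop
  have hneg : ∀ᶠ ε in 𝓝[>] (0 : ℝ), 1 - Real.exp (-lam * (h + ε) ^ 2)
      + Real.exp (-lam * (L - ε) ^ 2) - Real.exp (-lam * (L - h + ε) ^ 2) < 0 :=
    (hcont.continuousAt.eventually_lt_const h0).filter_mono nhdsWithin_le_nhds
  obtain ⟨ε, hε, hmem⟩ := (hneg.and (Ioo_mem_nhdsGT hL)).exists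
  exact ⟨ε, hmem.1, hmem.2, hε⟩

lemma sum_sum_mul_single_comb {ι κ : Type*} [Fintype ι] [Fintype κ] [DecidableEq ι]
    (p : κ → ι) (w : κ → ℝ) (G : ι → ι → ℝ) :
    ∑ i, ∑ j, (∑ a, w a * (Pi.single (p a) 1 : ι → ℝ) i) *
        (∑ b, w b * (Pi.single (p b) 1 : ι → ℝ) j) * G i j =
      ∑ a, ∑ b, w a * w b * G (p a) (p b) := by
  have hsum (w' : κ → ℝ) (f : ι → ℝ) :
      ∑ i, (∑ a, w' a * (Pi.single (p a) 1 : ι → ℝ) i) * f i = ∑ a, w' a * f (p a) := by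
    simp_rw [Finset.sum_mul]
    rw [Finset.sum_comm]
    simp [Pi.single_apply]
  simp_rw [mul_assoc, ← Finset.mul_sum, hsum]

/-- Four points forming two nearby pairs, each pair nearly antipodal to the other, have a
Gaussian Gram form which is negative at the alternating weights. -/
lemma gaussian_alternating_form_neg {X : Type*} [MetricSpace X] {lam L h ε : ℝ}
    (hlam : 0 < lam) (hεL : ε < L)
    (hneg : 1 - Real.exp (-lam * (h + ε) ^ 2) + Real.exp (-lam * (L - ε) ^ 2)
        - Real.exp (-lam * (L - h + ε) ^ 2) < 0)
    {y : Fin 4 → X} (h01 : dist (y 0) (y 1) ≤ h + ε) (h23 : dist (y 2) (y 3) ≤ h + ε)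
    (h02 : L - ε ≤ dist (y 0) (y 2)) (h13 : L - ε ≤ dist (y 1) (y 3))
    (h03 : dist (y 0) (y 3) ≤ L - h + ε) (h12 : dist (y 1) (y 2) ≤ L - h + ε) :
    ∑ a, ∑ b, (![1, -1, 1, -1] : Fin 4 → ℝ) a * (![1, -1, 1, -1] : Fin 4 → ℝ) b *
      Real.exp (-lam * dist (y a) (y b) ^ 2) < 0 := by
  have hanti {s t : ℝ} (hs : 0 ≤ s) (hst : s ≤ t) :
      Real.exp (-lam * t ^ 2) ≤ Real.exp (-lam * s ^ 2) :=
    Real.exp_le_exp.2 <| mul_le_mul_of_nonpos_left (pow_le_pow_left₀ hs hst 2) (by linarith)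
  have hL : 0 ≤ L - ε := by linarith
  have e01 := hanti dist_nonneg h01
  have e23 := hanti dist_nonneg h23
  have e02 := hanti hL h02
  have e13 := hanti hL h13
  have e03 := hanti dist_nonneg h03
  have e12 := hanti dist_nonneg h12
  simp only [Fin.sum_univ_four, dist_self, dist_comm (y 1) (y 0), dist_comm (y 2) (y 0),
    dist_comm (y 3) (y 0), dist_comm (y 2) (y 1), dist_comm (y 3) (y 1), dist_comm (y 3) (y 2)]
  simp
  simp only [neg_mul] at *
  linarith


/-- For every `λ > 0` and `ρ > 0` there are `N > 0` and `ε > 0` such that in any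
metric space, any `N` points whose pairwise distances agree, up to an error of at
most `ε`, with those of `N` equidistributed points on a round circle of
circumference `ρ` have a Gaussian Gram matrix (with parameter `λ`) that is not
positive semidefinite. -/
theorem gaussian_gram_near_equidistributed_circle_not_posSemidef
    (lam ρ : ℝ) (hlam : 0 < lam) (hρ : 0 < ρ) :
    ∃ (N : ℕ) (ε : ℝ), 0 < N ∧ 0 < ε ∧
      ∀ (X : Type*) [MetricSpace X] (x : Fin N → X),
        (∀ i j : Fin N,
          |dist (x i) (x j) -
            (ρ / N) * (min (((i : ℤ) - (j : ℤ)).natAbs) (N - ((i : ℤ) - (j : ℤ)).natAbs) : ℕ)|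
            ≤ ε) →
        ∃ v : Fin N → ℝ,
          ∑ i : Fin N, ∑ j : Fin N,
            v i * v j * Real.exp (-lam * dist (x i) (x j) ^ 2) < 0 := by
  set c := Real.exp (-lam * (ρ / 2) ^ 2) with hc_def
  have hc : 0 < c := Real.exp_pos _
  obtain ⟨M₀, hM₀⟩ := exists_nat_gt ((1 + c) / (2 * c))
  obtain ⟨M, hM2, hM⟩ : ∃ M : ℕ, 2 ≤ M ∧ (1 + c) / (2 * c) < M :=
    ⟨max M₀ 2, le_max_right _ _, hM₀.trans_le (by exact_mod_cast le_max_left M₀ 2)⟩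
  have hMpos : (0 : ℝ) < M := by exact_mod_cast (by omega : 0 < M)
  set h := ρ / (2 * M) with hh_def
  have hh : 0 < h := by positivity
  have hρh : ρ = 2 * M * h := by rw [hh_def]; field_simp
  have hsmall : h < c * (2 * (ρ / 2) - h) := by
    rw [div_lt_iff₀ (by positivity)] at hM
    rw [hρh]
    nlinarith
  obtain ⟨ε, hε, hεL, hneg⟩ :=
    exists_gaussian_alternating_energy_neg hlam (half_pos hρ) hh hsmall
  refine ⟨2 * M, ε, by omega, hε, fun X _ x hx ↦ ?_⟩
  let p : Fin 4 → Fin (2 * M) :=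
    ![⟨0, by omega⟩, ⟨1, by omega⟩, ⟨M, by omega⟩, ⟨M + 1, by omega⟩]
  have hdist (a b : Fin 4) (k : ℕ) (hk : min (((p a : ℤ) - (p b : ℤ)).natAbs)
      (2 * M - ((p a : ℤ) - (p b : ℤ)).natAbs) = k) :
      |dist (x (p a)) (x (p b)) - h * k| ≤ ε := by
    have := hx (p a) (p b)
    rw [hk] at this
    simpa [hh_def] using this
  have d01 := abs_le.1 (hdist 0 1 1 (by simp [p]; omega))
  have d23 := abs_le.1 (hdist 2 3 1 (by simp [p]; omega))
  have d02 := abs_le.1 (hdist 0 2 M (by simp [p]; omega))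
  have d13 := abs_le.1 (hdist 1 3 M (by simp [p]; omega))
  have d03 := abs_le.1 (hdist 0 3 (M - 1) (by simp [p]; omega))
  have d12 := abs_le.1 (hdist 1 2 (M - 1) (by simp [p]; omega))
  rw [Nat.cast_sub (by omega)] at d03 d12
  push_cast at d01 d23 d03 d12
  refine ⟨fun i ↦ ∑ a, (![1, -1, 1, -1] : Fin 4 → ℝ) a * (Pi.single (p a) 1 : _ → ℝ) i, ?_⟩
  rw [sum_sum_mul_single_comb p _ fun i j ↦ Real.exp (-lam * dist (x i) (x j) ^ 2)]
  exact gaussian_alternating_form_neg (y := fun a ↦ x (p a)) hlam hεL hneg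
    (by linarith) (by linarith) (by linarith) (by linarith) (by linarith) (by linarith)
end

section
/- For every ρ > 0 and every λ > 0, the Gaussian kernel k(x,y) = exp(−λ·dist(x,y)²) on the circle of circumference ρ (the quotient metric space ℝ/ρℤ) is not positive definite: there exist N ∈ ℕ, points x₁, …, x_N in ℝ/ρℤ, and a vector v ∈ ℝ^N such that Σ_{i,j} v_i v_j exp(−λ·dist(x_i,x_j)²) < 0. -/
theorem AddCircle.dist_coe_eq_abs_sub {p a b : ℝ} (hp : 0 < p) (h : |a - b| ≤ p / 2) :
    dist (a : AddCircle p) (b : AddCircle p) = |a - b| := by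
  rw [dist_eq_norm, ← AddCircle.coe_sub, AddCircle.norm_coe_eq_abs_iff p hp.ne', abs_of_pos hp]
  exact h

/-- Near the antipode, the increment of the Gaussian is of first order in the step, which beats
the second-order decrement at the origin. -/
theorem exists_gaussian_increment_lt {ρ lam : ℝ} (hρ : 0 < ρ) (hlam : 0 < lam) :
    ∃ h : ℝ, 0 < h ∧ h ≤ ρ / 4 ∧
      1 - Real.exp (-lam * h ^ 2) + Real.exp (-lam * (ρ / 2) ^ 2)
        < Real.exp (-lam * (ρ / 2 - h) ^ 2) := by
  set c := Real.exp (-lam * (ρ / 2) ^ 2) with hc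
  have hc0 : 0 < c := Real.exp_pos _
  have hc1 : c ≤ 1 := Real.exp_le_one_iff.mpr (by nlinarith [sq_nonneg (ρ / 2)])
  refine ⟨c * ρ / 4, by positivity, by nlinarith, ?_⟩
  set h := c * ρ / 4 with hh
  have hh0 : 0 < h := by positivity
  have hnear := Real.add_one_le_exp (-lam * h ^ 2)
  have hfar : c * (lam * (ρ * h - h ^ 2) + 1) ≤ Real.exp (-lam * (ρ / 2 - h) ^ 2) := by
    have hsplit : Real.exp (-lam * (ρ / 2 - h) ^ 2) = c * Real.exp (lam * (ρ * h - h ^ 2)) := by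
      rw [hc, ← Real.exp_add]
      ring_nf
    rw [hsplit]
    exact mul_le_mul_of_nonneg_left (Real.add_one_le_exp _) hc0.le
  have hstep : h ^ 2 < c * (ρ * h - h ^ 2) := by
    have hcρ : c * ρ = 4 * h := by rw [hh]; ring
    have : c * (ρ * h - h ^ 2) = 4 * h ^ 2 - c * h ^ 2 := by linear_combination h * hcρ
    nlinarith [mul_le_mul_of_nonneg_right hc1 (sq_nonneg h), pow_pos hh0 2]
  nlinarith [mul_lt_mul_of_pos_left hstep hlam]


/-- For every circumference `ρ > 0` and every `λ > 0`, the Gaussian kernel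
`k(x,y) = exp (-λ * dist(x,y)²)` on the circle `ℝ/ρℤ` (Mathlib's `AddCircle ρ`,
whose quotient distance is the geodesic distance of the round circle of
circumference `ρ`) is not positive definite: some finite Gram matrix fails to be
positive semidefinite. -/
theorem gaussian_kernel_addCircle_not_posDef (ρ lam : ℝ) (hρ : 0 < ρ) (hlam : 0 < lam) :
    ∃ (N : ℕ) (x : Fin N → AddCircle ρ) (v : Fin N → ℝ),
      ∑ i : Fin N, ∑ j : Fin N,
        v i * v j * Real.exp (-lam * dist (x i) (x j) ^ 2) < 0 := by
  obtain ⟨h, h0, h4, hlt⟩ := exists_gaussian_increment_lt hρ hlam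
  have hshift : ((ρ / 2 + h : ℝ) : AddCircle ρ) = ((h - ρ / 2 : ℝ) : AddCircle ρ) := by
    rw [← AddCircle.coe_add_period ρ (h - ρ / 2)]
    ring_nf
  have d01 : dist ((0 : ℝ) : AddCircle ρ) (h : ℝ) = h := by
    have e : |0 - h| = h := by rw [zero_sub, abs_neg, abs_of_pos h0]
    rw [AddCircle.dist_coe_eq_abs_sub hρ (by linarith), e]
  have d02 : dist ((0 : ℝ) : AddCircle ρ) (ρ / 2 : ℝ) = ρ / 2 := by
    have e : |0 - ρ / 2| = ρ / 2 := by rw [zero_sub, abs_neg, abs_of_pos (by linarith)]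
    rw [AddCircle.dist_coe_eq_abs_sub hρ e.le, e]
  have d03 : dist ((0 : ℝ) : AddCircle ρ) (ρ / 2 + h : ℝ) = ρ / 2 - h := by
    have e : |0 - (h - ρ / 2)| = ρ / 2 - h := by rw [abs_of_nonneg (by linarith)]; ring
    rw [hshift, AddCircle.dist_coe_eq_abs_sub hρ (by linarith), e]
  have d12 : dist ((h : ℝ) : AddCircle ρ) (ρ / 2 : ℝ) = ρ / 2 - h := by
    have e : |h - ρ / 2| = ρ / 2 - h := by rw [abs_of_nonpos (by linarith)]; ring
    rw [AddCircle.dist_coe_eq_abs_sub hρ (by linarith), e]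
  have d13 : dist ((h : ℝ) : AddCircle ρ) (ρ / 2 + h : ℝ) = ρ / 2 := by
    have e : |h - (ρ / 2 + h)| = ρ / 2 := by rw [abs_of_nonpos (by linarith)]; ring
    rw [AddCircle.dist_coe_eq_abs_sub hρ e.le, e]
  have d23 : dist ((ρ / 2 : ℝ) : AddCircle ρ) (ρ / 2 + h : ℝ) = h := by
    have e : |ρ / 2 - (ρ / 2 + h)| = h := by rw [abs_of_nonpos (by linarith)]; ring
    rw [AddCircle.dist_coe_eq_abs_sub hρ (by linarith), e]
  refine ⟨4, ![((0 : ℝ) : AddCircle ρ), (h : ℝ), (ρ / 2 : ℝ), (ρ / 2 + h : ℝ)],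
    ![1, -1, 1, -1], ?_⟩
  simp only [Fin.sum_univ_four, Matrix.cons_val]
  rw [dist_comm ((h : ℝ) : AddCircle ρ) (0 : ℝ), dist_comm ((ρ / 2 : ℝ) : AddCircle ρ) (0 : ℝ),
    dist_comm ((ρ / 2 + h : ℝ) : AddCircle ρ) (0 : ℝ), dist_comm ((ρ / 2 : ℝ) : AddCircle ρ) (h : ℝ),
    dist_comm ((ρ / 2 + h : ℝ) : AddCircle ρ) (h : ℝ),
    dist_comm ((ρ / 2 + h : ℝ) : AddCircle ρ) (ρ / 2 : ℝ), d01, d02, d03, d12, d13, d23]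
  simp only [dist_self, zero_pow two_ne_zero, mul_zero, Real.exp_zero]
  linarith
end

section
/- Let (X,d) be a metric space and suppose there exist ρ > 0 and a map f : ℝ/ρℤ → X that is distance preserving, i.e., d(f(a), f(b)) = dist(a,b) for all a, b in the circle of circumference ρ. Then for every λ > 0 the Gaussian kernel k(x,y) = exp(−λ·d(x,y)²) on X is not positive definite: there exist finitely many points x₁, …, x_N ∈ X and v ∈ ℝ^N with Σ_{i,j} v_i v_j exp(−λ·d(x_i,x_j)²) < 0. -/
/-- The quotient distance on the circle agrees with the distance on the line for points that are
at most half a circumference apart. -/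
theorem AddCircle.dist_coe_eq_abs_sub_s4 {ρ : ℝ} (hρ : 0 < ρ) {s t : ℝ} (h : |s - t| ≤ ρ / 2) :
    dist (s : AddCircle ρ) (t : AddCircle ρ) = |s - t| := by
  rw [dist_eq_norm, ← AddCircle.coe_sub, AddCircle.norm_coe_eq_abs_iff ρ hρ.ne', abs_of_pos hρ]
  exact h

/-- The kink of the Gaussian at the cut locus of the circle dominates its smooth behaviour on the
diagonal. -/
theorem exists_one_sub_gaussian_lt_antipodal_gap {ρ lam : ℝ} (hρ : 0 < ρ) (hlam : 0 < lam) :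
    ∃ ε : ℝ, 0 < ε ∧ ε ≤ ρ / 4 ∧
      1 - Real.exp (-lam * ε ^ 2) <
        Real.exp (-lam * (ρ / 2 - ε) ^ 2) - Real.exp (-lam * (ρ / 2) ^ 2) := by
  set E := Real.exp (-lam * (ρ / 2) ^ 2) with hE
  have hE0 : 0 < E := Real.exp_pos _
  have hE1 : E ≤ 1 := Real.exp_le_one_iff.2 (by nlinarith [sq_nonneg (ρ / 2)])
  have hle : E * ρ / 4 ≤ ρ / 4 := by nlinarith
  have hpos : 0 < E * ρ / 4 := by positivity
  refine ⟨E * ρ / 4, hpos, hle, ?_⟩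
  generalize hε : E * ρ / 4 = ε at *
  have h1 := Real.add_one_le_exp (-lam * ε ^ 2)
  have h2 := Real.add_one_le_exp (lam * ε * (ρ - ε))
  have h3 : Real.exp (-lam * (ρ / 2 - ε) ^ 2) = E * Real.exp (lam * ε * (ρ - ε)) := by
    rw [hE, ← Real.exp_add]
    ring_nf
  have h4 := mul_le_mul_of_nonneg_left h2 hE0.le
  have h5 : ε < E * (ρ - ε) := by nlinarith
  have h6 := mul_lt_mul_of_pos_left h5 (mul_pos hlam hpos)
  rw [h3]
  nlinarith


/-- If a metric space `X` admits a distance-preserving map from the round circle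
`ℝ/ρℤ` of some circumference `ρ > 0` (a metric-space isometric embedding of a
round circle), then for every `λ > 0` the Gaussian kernel
`k(x,y) = exp (-λ * dist(x,y)²)` on `X` is not positive definite. -/
theorem gaussian_kernel_not_posDef_of_isometric_circle
    {X : Type*} [MetricSpace X] (ρ : ℝ) (hρ : 0 < ρ)
    (f : AddCircle ρ → X) (hf : ∀ a b : AddCircle ρ, dist (f a) (f b) = dist a b)
    (lam : ℝ) (hlam : 0 < lam) :
    ∃ (N : ℕ) (x : Fin N → X) (v : Fin N → ℝ),
      ∑ i : Fin N, ∑ j : Fin N,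
        v i * v j * Real.exp (-lam * dist (x i) (x j) ^ 2) < 0 := by
  obtain ⟨ε, hε, hερ, hgap⟩ := exists_one_sub_gaussian_lt_antipodal_gap hρ hlam
  have hd (s t r : ℝ) (h : |s - t| = r) (hr : r ≤ ρ / 2) :
      dist (f (s : AddCircle ρ)) (f (t : AddCircle ρ)) = r := by
    rw [hf, AddCircle.dist_coe_eq_abs_sub_s4 hρ (h.trans_le hr), h]
  have h01 := hd 0 ε ε (by rw [zero_sub, abs_neg, abs_of_pos hε]) (by linarith)
  have h02 := hd 0 (ρ / 2) (ρ / 2) (by rw [zero_sub, abs_neg, abs_of_pos (by linarith)]) le_rfl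
  have h12 := hd ε (ρ / 2) (ρ / 2 - ε)
    (by rw [abs_sub_comm, abs_of_pos (by linarith)]) (by linarith)
  have h13 := hd ε (ρ / 2 + ε) (ρ / 2)
    (by rw [abs_sub_comm, abs_of_pos (by linarith)]; ring) le_rfl
  have h23 := hd (ρ / 2) (ρ / 2 + ε) ε
    (by rw [abs_sub_comm, abs_of_pos (by linarith)]; ring) (by linarith)
  have h03 := hd ρ (ρ / 2 + ε) (ρ / 2 - ε)
    (by rw [abs_of_pos (by linarith)]; ring) (by linarith)
  rw [AddCircle.coe_period, ← AddCircle.coe_zero] at h03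
  refine ⟨4, ![f ((0 : ℝ) : AddCircle ρ), f (ε : AddCircle ρ), f ((ρ / 2 : ℝ) : AddCircle ρ),
    f ((ρ / 2 + ε : ℝ) : AddCircle ρ)], ![1, -1, 1, -1], ?_⟩
  have h10 := (dist_comm _ _).trans h01
  have h20 := (dist_comm _ _).trans h02
  have h30 := (dist_comm _ _).trans h03
  have h21 := (dist_comm _ _).trans h12
  have h31 := (dist_comm _ _).trans h13
  have h32 := (dist_comm _ _).trans h23
  simp only [Fin.sum_univ_four, Matrix.cons_val, dist_self, h01, h02, h03, h12, h13, h23,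
    h10, h20, h30, h21, h31, h32]
  norm_num at hgap ⊢
  linarith
end

section
/- Let n ≥ 1 and let S^n = {x ∈ ℝ^{n+1} : ‖x‖ = 1} be the unit sphere in (n+1)-dimensional Euclidean space, equipped with its geodesic distance d(x,y) = arccos⟨x,y⟩. Then for every λ > 0 the Gaussian kernel k(x,y) = exp(−λ·d(x,y)²) on S^n is not positive definite: there exist finitely many points x₁, …, x_N ∈ S^n and v ∈ ℝ^N with Σ_{i,j} v_i v_j exp(−λ·(arccos⟨x_i,x_j⟩)²) < 0. -/
open Real in
theorem exists_pos_lt_pi_gaussian_gap {lam : ℝ} (hlam : 0 < lam) :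
    ∃ h : ℝ, 0 < h ∧ h < π ∧
      1 - exp (-lam * h ^ 2) + exp (-lam * π ^ 2) - exp (-lam * (π - h) ^ 2) < 0 := by
  set E := exp (-lam * π ^ 2) with hE
  have hE0 : 0 < E := exp_pos _
  have hE1 : E < 1 := exp_lt_one_iff.2 (by nlinarith [mul_pos hlam (pow_pos pi_pos 2)])
  have hpi := pi_gt_three
  refine ⟨E, hE0, by linarith, ?_⟩
  have h1 := add_one_le_exp (-lam * E ^ 2)
  have h2 := add_one_le_exp (lam * (2 * π * E - E ^ 2))
  have h3 : exp (-lam * (π - E) ^ 2) = E * exp (lam * (2 * π * E - E ^ 2)) := by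
    conv_rhs => rw [hE, ← exp_add]
    rw [← hE]
    congr 1
    ring
  have h4 := mul_le_mul_of_nonneg_left h2 hE0.le
  have h5 : 0 < lam * E ^ 2 * (2 * π - E - 1) := by
    have : 0 < 2 * π - E - 1 := by linarith
    positivity
  rw [h3]
  nlinarith

/-- The great circle through two orthonormal vectors realises the angle differences as inner
products. -/
theorem inner_cos_smul_add_sin_smul {V : Type*} [NormedAddCommGroup V] [InnerProductSpace ℝ V]
    {e f : V} (he : ‖e‖ = 1) (hf : ‖f‖ = 1) (hef : inner ℝ e f = 0) (s t : ℝ) :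
    inner ℝ (Real.cos s • e + Real.sin s • f) (Real.cos t • e + Real.sin t • f) =
      Real.cos (s - t) := by
  have hfe : inner ℝ f e = 0 := by rw [real_inner_comm, hef]
  simp only [inner_add_left, inner_add_right, real_inner_smul_left, real_inner_smul_right,
    real_inner_self_eq_norm_sq, he, hf, hef, hfe, Real.cos_sub]
  ring

/-- For `n ≥ 1`, the Gaussian kernel built from the geodesic distance
`d(x,y) = arccos ⟪x, y⟫` on the unit sphere `Sⁿ ⊆ ℝ^{n+1}` is not positive
definite for any parameter `λ > 0`. -/
theorem gaussian_kernel_sphere_not_posDef (n : ℕ) (hn : 1 ≤ n) (lam : ℝ) (hlam : 0 < lam) :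
    ∃ (N : ℕ) (x : Fin N → Metric.sphere (0 : EuclideanSpace ℝ (Fin (n + 1))) 1)
      (v : Fin N → ℝ),
      ∑ i : Fin N, ∑ j : Fin N,
        v i * v j *
          Real.exp (-lam *
            (Real.arccos (inner (𝕜 := ℝ)
              ((x i : EuclideanSpace ℝ (Fin (n + 1)))) ((x j : EuclideanSpace ℝ (Fin (n + 1)))))) ^ 2)
        < 0 := by
  obtain ⟨h, h0, hpi, hneg⟩ := exists_pos_lt_pi_gaussian_gap hlam
  obtain ⟨p, hp⟩ : ∃ p : ℝ → Metric.sphere (0 : EuclideanSpace ℝ (Fin (n + 1))) 1,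
      ∀ s t, inner ℝ (p s : EuclideanSpace ℝ (Fin (n + 1))) (p t) = Real.cos (s - t) := by
    let e : EuclideanSpace ℝ (Fin (n + 1)) := EuclideanSpace.single ⟨0, by lia⟩ 1
    let f : EuclideanSpace ℝ (Fin (n + 1)) := EuclideanSpace.single ⟨1, by lia⟩ 1
    have key := inner_cos_smul_add_sin_smul (e := e) (f := f) (by simp [e]) (by simp [f])
      (by simp [e, f, EuclideanSpace.inner_single_left, Fin.ext_iff])
    refine ⟨fun t => ⟨Real.cos t • e + Real.sin t • f, ?_⟩, key⟩
    have hsq := key t t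
    rw [real_inner_self_eq_norm_sq, sub_self, Real.cos_zero] at hsq
    rw [mem_sphere_zero_iff_norm]
    exact (pow_eq_one_iff_of_nonneg (norm_nonneg _) two_ne_zero).1 hsq
  have hcos : Real.arccos (Real.cos h) = h := Real.arccos_cos h0.le hpi.le
  have c1 : Real.cos (h - Real.pi) = -Real.cos h := Real.cos_sub_pi h
  have c2 : Real.cos (Real.pi - h) = -Real.cos h := Real.cos_pi_sub h
  have c3 : Real.cos (-Real.pi + -h) = -Real.cos h := by
    rw [← Real.cos_neg, ← Real.cos_add_pi]; ring_nf
  have c4 : Real.cos (h + Real.pi) = -Real.cos h := Real.cos_add_pi h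
  refine ⟨4, ![p 0, p h, p Real.pi, p (h + Real.pi)], ![1, -1, 1, -1], ?_⟩
  simp [Fin.sum_univ_four, hp, c1, c2, c3, c4, Real.arccos_neg, hcos]
  simp at hneg
  linarith
end

section
/- For ρ > 0 and ρ' > 0, consider the flat torus T = (ℝ/ρℤ) × (ℝ/ρ'ℤ) equipped with the L² product distance d((a,b),(a',b')) = √(dist(a,a')² + dist(b,b')²), which is the geodesic distance of the flat torus. Then for every λ > 0 the Gaussian kernel k(x,y) = exp(−λ·d(x,y)²) on T is not positive definite: there exist finitely many points x₁, …, x_N ∈ T and v ∈ ℝ^N with Σ_{i,j} v_i v_j exp(−λ·d(x_i,x_j)²) < 0. -/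
theorem AddCircle.dist_coe_eq_of_abs_sub_le {p x y d : ℝ} (hp : p ≠ 0)
    (hxy : |x - y| = d) (hd : d ≤ |p| / 2) :
    dist (x : AddCircle p) (y : AddCircle p) = d := by
  rw [dist_eq_norm, ← AddCircle.coe_sub, (AddCircle.norm_coe_eq_abs_iff p hp).2 (hxy ▸ hd), hxy]

/-- The drop `1 - exp (-λ h²)` of a Gaussian near its peak is smaller than its increment over
`[a - h, a]` once `h` is small. -/
theorem exists_one_sub_gaussian_lt_gaussian_sub {a lam : ℝ} (ha : 0 < a) (hlam : 0 < lam) :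
    ∃ h : ℝ, 0 < h ∧ h ≤ a ∧
      1 - Real.exp (-lam * h ^ 2) <
        Real.exp (-lam * (a - h) ^ 2) - Real.exp (-lam * a ^ 2) := by
  set E := Real.exp (-lam * a ^ 2) with hE
  have hE0 : 0 < E := Real.exp_pos _
  have hE1 : E ≤ 1 := Real.exp_le_one_iff.2 (by nlinarith [sq_nonneg a])
  have hha : a * E / 2 ≤ a := by nlinarith
  have hh0 : 0 < a * E / 2 := by positivity
  refine ⟨a * E / 2, hh0, hha, ?_⟩
  set h := a * E / 2 with hh
  have h1 := Real.add_one_le_exp (-lam * h ^ 2)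
  have h2 := Real.add_one_le_exp (lam * (h * (2 * a - h)))
  have h3 : Real.exp (-lam * (a - h) ^ 2) = E * Real.exp (lam * (h * (2 * a - h))) := by
    rw [hE, ← Real.exp_add]
    ring_nf
  have h4 : lam * h * (a * E) ≤ E * (lam * (h * (2 * a - h))) := by
    have : 0 ≤ lam * h * E * (a - h) := mul_nonneg (by positivity) (by linarith)
    linarith
  have h5 : lam * h * (a * E) = 2 * (lam * h ^ 2) := by rw [hh]; ring
  have h6 : 0 < lam * h ^ 2 := by positivity
  have h7 := mul_le_mul_of_nonneg_left h2 hE0.le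
  rw [h3]
  linarith

/-- The Gaussian kernel on the flat torus `(ℝ/ρℤ) × (ℝ/ρ'ℤ)` equipped with the
`L²` product distance `d((a,b),(a',b')) = √(dist(a,a')² + dist(b,b')²)` — the
geodesic distance of the flat torus — is not positive definite for any `λ > 0`. -/
theorem gaussian_kernel_flat_torus_not_posDef
    (ρ ρ' : ℝ) (hρ : 0 < ρ) (hρ' : 0 < ρ') (lam : ℝ) (hlam : 0 < lam) :
    ∃ (N : ℕ) (x : Fin N → AddCircle ρ × AddCircle ρ') (v : Fin N → ℝ),
      ∑ i : Fin N, ∑ j : Fin N,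
        v i * v j *
          Real.exp (-lam *
            (Real.sqrt (dist (x i).1 (x j).1 ^ 2 + dist (x i).2 (x j).2 ^ 2)) ^ 2) < 0 := by
  obtain ⟨h, hh0, hha, hlt⟩ := exists_one_sub_gaussian_lt_gaussian_sub (half_pos hρ) hlam
  have dist_eq {x y d : ℝ} (hxy : |x - y| = d) (hd : d ≤ ρ / 2) :
      dist (x : AddCircle ρ) (y : AddCircle ρ) = d :=
    AddCircle.dist_coe_eq_of_abs_sub_le hρ.ne' hxy (by rwa [abs_of_pos hρ])
  have d01 : dist ((0 : ℝ) : AddCircle ρ) (h : ℝ) = h :=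
    dist_eq (by rw [zero_sub, abs_neg, abs_of_pos hh0]) hha
  have d02 : dist ((0 : ℝ) : AddCircle ρ) (ρ / 2 : ℝ) = ρ / 2 :=
    dist_eq (by rw [zero_sub, abs_neg, abs_of_pos (half_pos hρ)]) le_rfl
  have d12 : dist (h : AddCircle ρ) (ρ / 2 : ℝ) = ρ / 2 - h :=
    dist_eq (by rw [abs_sub_comm, abs_of_nonneg (by linarith)]) (by linarith)
  have d13 : dist (h : AddCircle ρ) (ρ / 2 + h : ℝ) = ρ / 2 :=
    dist_eq (by rw [abs_sub_comm, abs_of_nonneg (by linarith)]; ring) le_rfl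
  have d23 : dist ((ρ / 2 : ℝ) : AddCircle ρ) (ρ / 2 + h : ℝ) = h :=
    dist_eq (by rw [abs_sub_comm, abs_of_nonneg (by linarith)]; ring) hha
  have d03 : dist ((0 : ℝ) : AddCircle ρ) (ρ / 2 + h : ℝ) = ρ / 2 - h := by
    have hwrap : ((0 : ℝ) : AddCircle ρ) = (ρ : ℝ) := by
      rw [AddCircle.coe_period, AddCircle.coe_zero]
    rw [hwrap]
    exact dist_eq (by rw [abs_of_nonneg (by linarith)]; ring) (by linarith)
  let p : Fin 4 → AddCircle ρ :=
    ![((0 : ℝ) : AddCircle ρ), (h : ℝ), (ρ / 2 : ℝ), (ρ / 2 + h : ℝ)]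
  refine ⟨4, fun i => (p i, 0), ![-1, 1, -1, 1], ?_⟩
  have hsq (i j : Fin 4) :
      Real.sqrt (dist (p i) (p j) ^ 2 + dist (0 : AddCircle ρ') 0 ^ 2) ^ 2 =
        dist (p i) (p j) ^ 2 := by
    rw [Real.sq_sqrt (by positivity), dist_self]
    ring
  simp only [hsq]
  have e01 : dist (p 0) (p 1) = h := d01
  have e02 : dist (p 0) (p 2) = ρ / 2 := d02
  have e03 : dist (p 0) (p 3) = ρ / 2 - h := d03
  have e12 : dist (p 1) (p 2) = ρ / 2 - h := d12
  have e13 : dist (p 1) (p 3) = ρ / 2 := d13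
  have e23 : dist (p 2) (p 3) = h := d23
  simp only [Fin.sum_univ_four, dist_self, dist_comm (p 1) (p 0), dist_comm (p 2) (p 0),
    dist_comm (p 3) (p 0), dist_comm (p 2) (p 1), dist_comm (p 3) (p 1), dist_comm (p 3) (p 2),
    e01, e02, e03, e12, e13, e23]
  simp only [Matrix.cons_val, ne_eq, OfNat.ofNat_ne_zero, not_false_eq_true, zero_pow, mul_zero,
    Real.exp_zero]
  linarith
end

section
/- For every λ > 0 and every ρ > 0 there exists a natural number N > 0 divisible by 4 such that for the N equidistributed points x_k = kρ/N (k = 0, 1, …, N−1) on the circle ℝ/ρℤ of circumference ρ, the Gaussian Gram matrix G with entries G_{ij} = exp(−λ·dist(x_i,x_j)²) is not positive semidefinite: there exists v ∈ ℝ^N with vᵀ G v < 0. -/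
/-- On `ℝ/ρℤ`, representatives differing by `d` or `d - ρ` with `0 ≤ d ≤ ρ / 2` are at
distance `d`. -/
lemma AddCircle.dist_coe_eq_of_sub {ρ x y d : ℝ} (hρ : 0 < ρ) (hd : 0 ≤ d) (hdρ : d ≤ ρ / 2)
    (h : x - y = d ∨ x - y = d - ρ) :
    dist (x : AddCircle ρ) (y : AddCircle ρ) = d := by
  have hnorm : ‖((d : ℝ) : AddCircle ρ)‖ = d := by
    rw [(AddCircle.norm_coe_eq_abs_iff ρ hρ.ne').2, abs_of_nonneg hd]
    rwa [abs_of_nonneg hd, abs_of_pos hρ]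
  rw [dist_eq_norm, ← AddCircle.coe_sub]
  rcases h with h | h
  · rw [h, hnorm]
  · rw [h, AddCircle.coe_sub, AddCircle.coe_period, sub_zero, hnorm]

/-- A step `h` away from the antipode gains more in the Gaussian than a step `h` away from the
origin loses, once `h` is small. -/
lemma Real.one_sub_exp_lt_exp_sub_exp {a h : ℝ} (ha : 0 < a) (h0 : 0 < h)
    (hh : 2 * h < Real.exp (-a / 4)) :
    1 - Real.exp (-a * h ^ 2) <
      Real.exp (-a * (1 / 2 - h) ^ 2) - Real.exp (-a * (1 / 2) ^ 2) := by
  have hE : Real.exp (-a / 4) ≤ 1 := Real.exp_le_one_iff.2 (by linarith)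
  have h1 : 1 - a * h ^ 2 ≤ Real.exp (-a * h ^ 2) := by
    linarith [Real.add_one_le_exp (-a * h ^ 2)]
  have h2 : a * (h - h ^ 2) + 1 ≤ Real.exp (a * (h - h ^ 2)) := Real.add_one_le_exp _
  have e1 : Real.exp (-a * (1 / 2 - h) ^ 2) =
      Real.exp (-a / 4) * Real.exp (a * (h - h ^ 2)) := by
    rw [← Real.exp_add]; congr 1; ring
  have e2 : Real.exp (-a * (1 / 2) ^ 2) = Real.exp (-a / 4) := by congr 1; ring
  rw [e1, e2]
  have h3 := mul_le_mul_of_nonneg_left h2 (Real.exp_pos (-a / 4)).le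
  have h4 : 0 < a * h * (Real.exp (-a / 4) * (1 - h) - h) :=
    mul_pos (mul_pos ha h0) (by nlinarith)
  nlinarith

/-- A quadratic form evaluated at `δ_p - δ_q + δ_r - δ_s`. -/
lemma sum_sum_single_sub_add_sub {ι : Type*} [Fintype ι] [DecidableEq ι] (K : ι → ι → ℝ)
    (p q r s : ι) :
    let v : ι → ℝ := Pi.single p 1 - Pi.single q 1 + Pi.single r 1 - Pi.single s 1
    ∑ i, ∑ j, v i * v j * K i j =
      (K p p - K p q + K p r - K p s) - (K q p - K q q + K q r - K q s) +
      (K r p - K r q + K r r - K r s) - (K s p - K s q + K s r - K s s) := by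
  simp [Pi.single_apply, sub_mul, add_mul, Finset.sum_add_distrib, Finset.sum_sub_distrib]

/-- For every `λ > 0` and circumference `ρ > 0` there is a positive `N` divisible
by 4 such that the Gaussian Gram matrix of the `N` equidistributed points
`x_k = kρ/N` on the circle `ℝ/ρℤ` (Mathlib's `AddCircle ρ`) with parameter `λ` is
not positive semidefinite: some `v` gives `vᵀ G v < 0`. -/
theorem gaussian_gram_equidistributed_addCircle_not_posSemidef
    (lam ρ : ℝ) (hlam : 0 < lam) (hρ : 0 < ρ) :
    ∃ N : ℕ, 0 < N ∧ 4 ∣ N ∧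
      ∃ v : Fin N → ℝ,
        ∑ i : Fin N, ∑ j : Fin N,
          v i * v j *
            Real.exp (-lam *
              dist (((i : ℕ) * ρ / N : ℝ) : AddCircle ρ)
                   (((j : ℕ) * ρ / N : ℝ) : AddCircle ρ) ^ 2) < 0 := by
  obtain ⟨m, hm⟩ := exists_nat_gt (Real.exp (lam * ρ ^ 2 / 4))
  have hmR : (0 : ℝ) < m := (Real.exp_pos _).trans hm
  have hm0 : 0 < m := by exact_mod_cast hmR
  refine ⟨4 * m, by omega, dvd_mul_right 4 m, ?_⟩
  set h : ℝ := 1 / (4 * m) with hh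
  have hpos : 0 < h := by positivity
  have hsmall : 2 * h < Real.exp (-(lam * ρ ^ 2) / 4) := by
    rw [neg_div, Real.exp_neg, hh, ← one_div, show 2 * (1 / (4 * (m : ℝ))) = 1 / (2 * m) by
      field_simp; norm_num]
    exact one_div_lt_one_div_of_lt (Real.exp_pos _) (by linarith)
  have hquarter : h ≤ 1 / 4 := by
    have : (1 : ℝ) ≤ m := by exact_mod_cast hm0
    rw [hh]
    exact one_div_le_one_div_of_le (by norm_num) (by linarith)
  have hmh : (m : ℝ) * h = 1 / 4 := by rw [hh]; field_simp
  have hpt : ∀ k : ℕ, (k : ℝ) * ρ / ((4 * m : ℕ) : ℝ) = k * h * ρ := fun k => by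
    rw [hh]; push_cast; ring
  have hkey := Real.one_sub_exp_lt_exp_sub_exp (by positivity : 0 < lam * ρ ^ 2) hpos hsmall
  have hdist : ∀ (k l : ℕ) (t : ℝ), 0 ≤ t → t ≤ 1 / 2 →
      ((k : ℝ) * h - l * h = t ∨ (k : ℝ) * h - l * h = t - 1) →
      Real.exp (-lam * dist (((k : ℝ) * h * ρ : ℝ) : AddCircle ρ)
        (((l : ℝ) * h * ρ : ℝ) : AddCircle ρ) ^ 2) = Real.exp (-(lam * ρ ^ 2) * t ^ 2) := by
    intro k l t ht ht2 hkl
    rw [AddCircle.dist_coe_eq_of_sub (d := t * ρ) hρ (by positivity) (by nlinarith)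
      (hkl.imp (fun H => by rw [← H]; ring) (fun H => by linear_combination ρ * H))]
    congr 1; ring
  let p : Fin (4 * m) := ⟨0, by omega⟩
  let q : Fin (4 * m) := ⟨1, by omega⟩
  let r : Fin (4 * m) := ⟨2 * m, by omega⟩
  let s : Fin (4 * m) := ⟨2 * m + 1, by omega⟩
  refine ⟨Pi.single p 1 - Pi.single q 1 + Pi.single r 1 - Pi.single s 1, ?_⟩
  rw [sum_sum_single_sub_add_sub (fun i j : Fin (4 * m) => Real.exp (-lam *
    dist (((i : ℕ) * ρ / (4 * m : ℕ) : ℝ) : AddCircle ρ)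
      (((j : ℕ) * ρ / (4 * m : ℕ) : ℝ) : AddCircle ρ) ^ 2))]
  have hself : ∀ x : AddCircle ρ, Real.exp (-lam * dist x x ^ 2) = 1 := by simp
  have hqp := hdist 1 0 h hpos.le (by linarith) (Or.inl (by push_cast; ring))
  have hrp := hdist (2 * m) 0 (1 / 2) (by norm_num) le_rfl (Or.inl (by push_cast; linarith))
  have hps := hdist 0 (2 * m + 1) (1 / 2 - h) (by linarith) (by linarith)
    (Or.inr (by push_cast; linarith))
  have hrq := hdist (2 * m) 1 (1 / 2 - h) (by linarith) (by linarith)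
    (Or.inl (by push_cast; linarith))
  have hsq := hdist (2 * m + 1) 1 (1 / 2) (by norm_num) le_rfl
    (Or.inl (by push_cast; linarith))
  have hsr := hdist (2 * m + 1) (2 * m) h hpos.le (by linarith) (Or.inl (by push_cast; ring))
  have hpq := hqp
  have hpr := hrp
  have hsp := hps
  have hqr := hrq
  have hqs := hsq
  have hrs := hsr
  rw [dist_comm] at hpq hpr hsp hqr hqs hrs
  simp only [hpt, hself, p, q, r, s, hqp, hrp, hps, hrq, hsq, hsr, hpq, hpr, hsp, hqr, hqs, hrs]
  linarith
end
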